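/- arXiv:2402.02083 — 2 statements merged into one kernel-verified Lean document; each statement's English description precedes it below -/
import Mathlib

section
/- Let G be a finite simple graph containing a vertex v of degree 9 with distinct neighbors u_1, …, u_9 such that u_i u_{i+1} ∈ E(G) for i = 1, …, 8 and u_1 u_9 ∉ E(G) (so {v, u_1, …, u_9} is a 9-fan with hub v that is not a wheel). Suppose d(u_2) = d(u_4) = d(u_6) = 3, d(u_8) ≤ 5, and {u_2, u_4, u_6, u_8} is an independent set in G. Then there exists a set B of at most 8 edges of G such that γ_i(G − B) > γ_i(G); that is, b_i(G) ≤ 8. -/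
open scoped BigOperators

/-- A set of vertices is an independent dominating set: it is independent
(no two of its vertices are adjacent) and dominating (every vertex is in it
or adjacent to a vertex in it). -/
def SimpleGraph.IsIndepDomSet {V : Type*} (G : SimpleGraph V) (S : Set V) : Prop :=
  (∀ u ∈ S, ∀ w ∈ S, ¬ G.Adj u w) ∧ ∀ x, x ∈ S ∨ ∃ u ∈ S, G.Adj u x

/-- The independent domination number: the minimum cardinality of an
independent dominating set. -/
noncomputable def SimpleGraph.indepDomNum {V : Type*} (G : SimpleGraph V) : ℕ :=
  sInf {n | ∃ S : Set V, G.IsIndepDomSet S ∧ S.ncard = n}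

namespace SimpleGraph

variable {V : Type*}

/-- An independent set that dominates everything outside `U` extends, by vertices of `U`, to an
independent dominating set. -/
theorem exists_isIndepDomSet_between [Finite V] (G : SimpleGraph V) (T U : Set V)
    (hT : ∀ x ∈ T, ∀ y ∈ T, ¬ G.Adj x y)
    (hU : ∀ x, x ∈ U ∨ x ∈ T ∨ ∃ w ∈ T, G.Adj w x) :
    ∃ S, T ⊆ S ∧ S ⊆ T ∪ U ∧ G.IsIndepDomSet S := by
  obtain ⟨S, -, hS⟩ := (Set.toFinite {S : Set V | T ⊆ S ∧ S ⊆ T ∪ U ∧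
    ∀ x ∈ S, ∀ y ∈ S, ¬ G.Adj x y}).exists_le_maximal
      (show T ∈ _ from ⟨subset_rfl, Set.subset_union_left, hT⟩)
  obtain ⟨⟨hTS, hSU, hI⟩, hmax⟩ := hS
  refine ⟨S, hTS, hSU, hI, fun x ↦ ?_⟩
  by_contra! hx
  rcases hU x with hxU | hxT | ⟨w, hw, hwx⟩
  · refine hx.1 (hmax ⟨hTS.trans (Set.subset_insert x S),
      Set.insert_subset (Or.inr hxU) hSU, ?_⟩ (Set.subset_insert x S) (Set.mem_insert x S))
    rintro a (rfl | ha) b (rfl | hb) hab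
    · exact hab.ne rfl
    · exact hx.2 b hb hab.symm
    · exact hx.2 a ha hab
    · exact hI a ha b hb hab
  · exact hx.1 (hTS hxT)
  · exact hx.2 w (hTS hw) hwx

theorem indepDomNum_le_add [Finite V] (G : SimpleGraph V) (T U : Set V)
    (hT : ∀ x ∈ T, ∀ y ∈ T, ¬ G.Adj x y)
    (hU : ∀ x, x ∈ U ∨ x ∈ T ∨ ∃ w ∈ T, G.Adj w x) :
    G.indepDomNum ≤ T.ncard + U.ncard := by
  obtain ⟨S, -, hSU, hS⟩ := exists_isIndepDomSet_between G T U hT hU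
  calc G.indepDomNum ≤ S.ncard := Nat.sInf_le ⟨S, hS, rfl⟩
    _ ≤ (T ∪ U).ncard := Set.ncard_le_ncard hSU
    _ ≤ T.ncard + U.ncard := Set.ncard_union_le T U

theorem exists_isIndepDomSet_ncard_eq_indepDomNum [Finite V] (G : SimpleGraph V) :
    ∃ S : Set V, G.IsIndepDomSet S ∧ S.ncard = G.indepDomNum := by
  obtain ⟨S, -, -, hS⟩ := exists_isIndepDomSet_between G ∅ Set.univ (by simp) (by simp)
  exact Nat.sInf_mem (s := {n | ∃ S : Set V, G.IsIndepDomSet S ∧ S.ncard = n}) ⟨_, S, hS, rfl⟩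

theorem IsIndepDomSet.not_adj_of_subset {G : SimpleGraph V} {B : Set (Sym2 V)} {S T : Set V}
    (hS : (G.deleteEdges B).IsIndepDomSet S) (hTS : T ⊆ S)
    (hT : ∀ x ∈ T, ∀ y ∈ T, s(x, y) ∉ B) : ∀ x ∈ T, ∀ y ∈ T, ¬ G.Adj x y :=
  fun x hx y hy hxy ↦ hS.1 x (hTS hx) y (hTS hy) ((deleteEdges_adj).2 ⟨hxy, hT x hx y hy⟩)

/-- To see that `T` dominates everything outside `U`, it is enough to look at the closed
neighborhoods of the vertices of `S` which are not in `T`. -/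
theorem IsIndepDomSet.dominates {G : SimpleGraph V} {B : Set (Sym2 V)} {S T U : Set V}
    (hS : (G.deleteEdges B).IsIndepDomSet S)
    (hmem : ∀ x ∈ S, x ∉ T → x ∈ U ∨ x ∈ T ∨ ∃ w ∈ T, G.Adj w x)
    (hadj : ∀ w ∈ S, w ∉ T → ∀ x, G.Adj w x → s(w, x) ∉ B →
      x ∈ U ∨ x ∈ T ∨ ∃ w ∈ T, G.Adj w x) (x : V) :
    x ∈ U ∨ x ∈ T ∨ ∃ w ∈ T, G.Adj w x := by
  rcases hS.2 x with hx | ⟨w, hw, hwx⟩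
  · by_cases hxT : x ∈ T
    · exact Or.inr (Or.inl hxT)
    · exact hmem x hx hxT
  · rw [deleteEdges_adj] at hwx
    by_cases hwT : w ∈ T
    · exact Or.inr (Or.inr ⟨w, hwT, hwx.1⟩)
    · exact hadj w hw hwT x hwx.1 hwx.2

/-- A fan with hub `v` of degree nine and path `a₀, …, a₈`, in which `a₁`, `a₃`, `a₅` have
degree three and `a₇` has at most two neighbors outside the fan. -/
structure NineFan (G : SimpleGraph V) (v a₀ a₁ a₂ a₃ a₄ a₅ a₆ a₇ a₈ : V) : Prop where
  nodup : [v, a₀, a₁, a₂, a₃, a₄, a₅, a₆, a₇, a₈].Nodup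
  adj_hub : ∀ x, G.Adj v x ↔
    x = a₀ ∨ x = a₁ ∨ x = a₂ ∨ x = a₃ ∨ x = a₄ ∨ x = a₅ ∨ x = a₆ ∨ x = a₇ ∨ x = a₈
  adj₁ : ∀ x, G.Adj a₁ x ↔ x = v ∨ x = a₀ ∨ x = a₂
  adj₃ : ∀ x, G.Adj a₃ x ↔ x = v ∨ x = a₂ ∨ x = a₄
  adj₅ : ∀ x, G.Adj a₅ x ↔ x = v ∨ x = a₄ ∨ x = a₆
  adj₆₇ : G.Adj a₆ a₇
  adj₇₈ : G.Adj a₇ a₈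
  ncard_le : (G.neighborSet a₇ \ {v, a₆, a₈}).ncard ≤ 2

namespace NineFan

variable {G : SimpleGraph V} {v a₀ a₁ a₂ a₃ a₄ a₅ a₆ a₇ a₈ : V}

/-- The edges at `a₁` other than `a₁a₂`, the edges at `a₃`, and `va₅`, `va₆`, `va₈`. -/
def cutEdges [DecidableEq V] (_ : G.NineFan v a₀ a₁ a₂ a₃ a₄ a₅ a₆ a₇ a₈) : Finset (Sym2 V) :=
  [s(a₁, a₀), s(a₁, v), s(a₃, v), s(a₃, a₂), s(a₃, a₄), s(v, a₅), s(v, a₆), s(v, a₈)].toFinset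

theorem mem_cutEdges [DecidableEq V] (h : G.NineFan v a₀ a₁ a₂ a₃ a₄ a₅ a₆ a₇ a₈) (x y : V) :
    s(x, y) ∈ (h.cutEdges : Set (Sym2 V)) ↔
      (x = a₁ ∧ y = a₀ ∨ x = a₀ ∧ y = a₁) ∨ (x = a₁ ∧ y = v ∨ x = v ∧ y = a₁) ∨
      (x = a₃ ∧ y = v ∨ x = v ∧ y = a₃) ∨ (x = a₃ ∧ y = a₂ ∨ x = a₂ ∧ y = a₃) ∨
      (x = a₃ ∧ y = a₄ ∨ x = a₄ ∧ y = a₃) ∨ (x = v ∧ y = a₅ ∨ x = a₅ ∧ y = v) ∨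
      (x = v ∧ y = a₆ ∨ x = a₆ ∧ y = v) ∨ (x = v ∧ y = a₈ ∨ x = a₈ ∧ y = v) := by
  simp [cutEdges]

theorem exists_smaller [Finite V] [DecidableEq V] (h : G.NineFan v a₀ a₁ a₂ a₃ a₄ a₅ a₆ a₇ a₈)
    {S : Set V} (hS : (G.deleteEdges ↑h.cutEdges).IsIndepDomSet S) :
    ∃ T U : Set V, (∀ x ∈ T, ∀ y ∈ T, ¬ G.Adj x y) ∧
      (∀ x, x ∈ U ∨ x ∈ T ∨ ∃ w ∈ T, G.Adj w x) ∧ T.ncard + U.ncard < S.ncard := by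
  have hadj := h.adj_hub
  have hadj₁ := h.adj₁
  have hadj₃ := h.adj₃
  have hadj₅ := h.adj₅
  have hcut := h.mem_cutEdges
  have nodup := h.nodup
  simp only [List.nodup_cons, List.mem_cons, List.not_mem_nil, not_or, or_false,
    List.nodup_nil, not_false_eq_true, and_true] at nodup
  obtain ⟨⟨nv0, nv1, nv2, nv3, nv4, nv5, nv6, nv7, nv8⟩, ⟨n01, n02, n03, n04, n05, n06, n07, n08⟩,
    ⟨n12, n13, n14, n15, n16, n17, n18⟩, ⟨n23, n24, n25, n26, n27, n28⟩,
    ⟨n34, n35, n36, n37, n38⟩, ⟨n45, n46, n47, n48⟩, ⟨n56, n57, n58⟩, ⟨n67, n68⟩, n78⟩ := nodup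
  have sdiff_lt : ∀ {R : Set V} {x : V}, x ∈ R → x ∈ S →
      (S \ R).ncard + (∅ : Set V).ncard < S.ncard := fun {R x} hxR hxS ↦ by
    rw [Set.ncard_empty, add_zero]
    exact Set.ncard_lt_ncard (Set.sdiff_subset.ssubset_of_mem_notMem hxS fun hx ↦ hx.2 hxR)
  have indep : ∀ {R : Set V}, ¬ (a₁ ∈ S \ R ∧ a₀ ∈ S \ R) → ¬ (a₁ ∈ S \ R ∧ v ∈ S \ R) →
      ¬ (a₃ ∈ S \ R ∧ v ∈ S \ R) → ¬ (a₃ ∈ S \ R ∧ a₂ ∈ S \ R) → ¬ (a₃ ∈ S \ R ∧ a₄ ∈ S \ R) →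
      ¬ (v ∈ S \ R ∧ a₅ ∈ S \ R) → ¬ (v ∈ S \ R ∧ a₆ ∈ S \ R) → ¬ (v ∈ S \ R ∧ a₈ ∈ S \ R) →
      ∀ x ∈ S \ R, ∀ y ∈ S \ R, ¬ G.Adj x y := by
    intro R e₁ e₂ e₃ e₄ e₅ e₆ e₇ e₈
    refine hS.not_adj_of_subset Set.sdiff_subset fun x hx y hy hxy ↦ ?_
    rcases (hcut x y).1 hxy with (⟨rfl, rfl⟩ | ⟨rfl, rfl⟩) | (⟨rfl, rfl⟩ | ⟨rfl, rfl⟩) |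
      (⟨rfl, rfl⟩ | ⟨rfl, rfl⟩) | (⟨rfl, rfl⟩ | ⟨rfl, rfl⟩) | (⟨rfl, rfl⟩ | ⟨rfl, rfl⟩) |
      (⟨rfl, rfl⟩ | ⟨rfl, rfl⟩) | (⟨rfl, rfl⟩ | ⟨rfl, rfl⟩) | (⟨rfl, rfl⟩ | ⟨rfl, rfl⟩) <;>
    first
      | exact e₁ ⟨‹_›, ‹_›⟩ | exact e₂ ⟨‹_›, ‹_›⟩ | exact e₃ ⟨‹_›, ‹_›⟩ | exact e₄ ⟨‹_›, ‹_›⟩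
      | exact e₅ ⟨‹_›, ‹_›⟩ | exact e₆ ⟨‹_›, ‹_›⟩ | exact e₇ ⟨‹_›, ‹_›⟩ | exact e₈ ⟨‹_›, ‹_›⟩
  have dom : ∀ {T U : Set V} {w x : V}, w ∈ T → G.Adj w x → x ∈ U ∨ x ∈ T ∨ ∃ w ∈ T, G.Adj w x :=
    fun hw hwx ↦ Or.inr (Or.inr ⟨_, hw, hwx⟩)
  have removed : ∀ {R : Set V} {w : V}, w ∈ S → w ∉ S \ R → w ∈ R :=
    fun hw hwR ↦ by_contra fun hR ↦ hwR ⟨hw, hR⟩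
  have excl : ∀ {x y : V}, G.Adj x y → s(x, y) ∉ (h.cutEdges : Set (Sym2 V)) → x ∈ S → y ∉ S :=
    fun hxy hB hx hy ↦ hS.1 _ hx _ hy (deleteEdges_adj.2 ⟨hxy, hB⟩)
  have hdom : ∀ x, x ∉ S → ∃ w ∈ S, G.Adj x w ∧ s(x, w) ∉ (h.cutEdges : Set (Sym2 V)) :=
    fun x hx ↦ by
      obtain ⟨w, hw, hwx⟩ := (hS.2 x).resolve_left hx
      exact ⟨w, hw, deleteEdges_adj.1 hwx.symm⟩
  have x12 : a₁ ∈ S → a₂ ∉ S := excl (by grind) (by grind)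
  have xv0 : v ∈ S → a₀ ∉ S := excl (by grind) (by grind)
  have xv2 : v ∈ S → a₂ ∉ S := excl (by grind) (by grind)
  have xv4 : v ∈ S → a₄ ∉ S := excl (by grind) (by grind)
  have xv7 : v ∈ S → a₇ ∉ S := excl (by grind) (by grind)
  have x67 : a₆ ∈ S → a₇ ∉ S := excl h.adj₆₇ (by grind)
  have x78 : a₇ ∈ S → a₈ ∉ S := excl h.adj₇₈ (by grind)
  have m3 : a₃ ∈ S := by
    by_contra m3
    obtain ⟨w, hw, hadj, hB⟩ := hdom a₃ m3
    grind
  have d1 : a₁ ∉ S → a₂ ∈ S := fun m1 ↦ by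
    obtain ⟨w, hw, hadj, hB⟩ := hdom a₁ m1
    grind
  have d5 : a₅ ∉ S → a₄ ∉ S → a₆ ∈ S := fun m5 m4 ↦ by
    obtain ⟨w, hw, hadj, hB⟩ := hdom a₅ m5
    grind
  have dv : v ∉ S → a₀ ∉ S → a₂ ∉ S → a₄ ∉ S → a₇ ∈ S := fun mv m0 m2 m4 ↦ by
    obtain ⟨w, hw, hadj, hB⟩ := hdom v mv
    grind
  clear hdom excl
  by_cases m2 : a₂ ∈ S
  · have mv : v ∉ S := fun mv ↦ xv2 mv m2
    have m1 : a₁ ∉ S := fun m1 ↦ x12 m1 m2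
    refine ⟨S \ {a₃}, ∅, indep (by simp [m1]) (by simp [mv]) (by simp) (by simp) (by simp)
      (by simp [mv]) (by simp [mv]) (by simp [mv]),
      hS.dominates (fun x hx hxR ↦ ?_) (fun w hw hwR x hwx hB ↦ ?_),
      sdiff_lt rfl m3⟩
    · obtain rfl := removed hx hxR
      exact dom (w := a₂) ⟨m2, n23⟩ (by grind [G.adj_comm])
    · obtain rfl := removed hw hwR
      grind
  have m1 : a₁ ∈ S := by_contra fun m1 ↦ m2 (d1 m1)
  have e1v : G.Adj a₁ v := (hadj₁ v).2 (by simp)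
  have e10 : G.Adj a₁ a₀ := (hadj₁ a₀).2 (by simp)
  have e12 : G.Adj a₁ a₂ := (hadj₁ a₂).2 (by simp)
  have e3v : G.Adj a₃ v := (hadj₃ v).2 (by simp)
  have e32 : G.Adj a₃ a₂ := (hadj₃ a₂).2 (by simp)
  have e34 : G.Adj a₃ a₄ := (hadj₃ a₄).2 (by simp)
  by_cases mv : v ∈ S
  · have m0 := xv0 mv
    have m4 := xv4 mv
    have m7 := xv7 mv
    by_cases m68 : a₆ ∈ S ∨ a₈ ∈ S
    · refine ⟨S \ {v}, ∅, indep (by simp [m0]) (by simp) (by simp) (by simp [m2]) (by simp [m4])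
        (by simp) (by simp) (by simp), hS.dominates (fun x hx hxR ↦ ?_) (fun w hw hwR x hwx hB ↦ ?_),
        sdiff_lt rfl mv⟩
      · obtain rfl := removed hx hxR
        exact dom (w := a₁) ⟨m1, Ne.symm nv1⟩ e1v
      · obtain rfl := removed hw hwR
        rcases (hadj x).1 hwx with rfl | rfl | rfl | rfl | rfl | rfl | rfl | rfl | rfl
        · exact dom (w := a₁) ⟨m1, Ne.symm nv1⟩ e10
        · exact Or.inr (Or.inl ⟨m1, Ne.symm nv1⟩)
        · exact dom (w := a₁) ⟨m1, Ne.symm nv1⟩ e12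
        · exact Or.inr (Or.inl ⟨m3, Ne.symm nv3⟩)
        · exact dom (w := a₃) ⟨m3, Ne.symm nv3⟩ e34
        · exact (hB ((hcut _ _).2 (by simp))).elim
        · exact (hB ((hcut _ _).2 (by simp))).elim
        · rcases m68 with m6 | m8
          · exact dom (w := a₆) ⟨m6, Ne.symm nv6⟩ h.adj₆₇
          · exact dom (w := a₈) ⟨m8, Ne.symm nv8⟩ h.adj₇₈.symm
        · exact (hB ((hcut _ _).2 (by simp))).elim
    · have m6 : a₆ ∉ S := fun m6 ↦ m68 (Or.inl m6)
      have m8 : a₈ ∉ S := fun m8 ↦ m68 (Or.inr m8)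
      have m5 : a₅ ∈ S := by_contra fun m5 ↦ m6 (d5 m5 m4)
      have hvR : v ∈ S \ {a₁, a₃, a₅} := ⟨mv, by simp [nv1, nv3, nv5]⟩
      have hub : ∀ {x}, G.Adj v x ∨ x = v →
          x ∈ (∅ : Set V) ∨ x ∈ S \ {a₁, a₃, a₅} ∨ ∃ w ∈ S \ {a₁, a₃, a₅}, G.Adj w x := by
        rintro x (hx | rfl)
        exacts [dom hvR hx, Or.inr (Or.inl hvR)]
      refine ⟨S \ {a₁, a₃, a₅}, ∅, indep (by simp) (by simp) (by simp) (by simp) (by simp)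
        (by simp) (by simp [m6]) (by simp [m8]),
        hS.dominates (fun x hx hxR ↦ hub ?_) (fun w hw hwR x hwx hB ↦ hub ?_),
        sdiff_lt (by simp) m5⟩
      · rcases removed hx hxR with rfl | rfl | rfl <;> simp [hadj]
      · rw [hadj]
        rcases removed hw hwR with rfl | rfl | rfl
        · rcases (hadj₁ x).1 hwx with rfl | rfl | rfl <;> simp
        · rcases (hadj₃ x).1 hwx with rfl | rfl | rfl <;> simp
        · rcases (hadj₅ x).1 hwx with rfl | rfl | rfl <;> simp
  by_cases m0 : a₀ ∈ S
  · by_cases m4 : a₄ ∈ S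
    · have h0 : a₀ ∈ S \ {a₁, a₃} := ⟨m0, by simp [n01, n03]⟩
      have h4 : a₄ ∈ S \ {a₁, a₃} := ⟨m4, by simp [Ne.symm n14, Ne.symm n34]⟩
      have ev : G.Adj a₀ v := ((hadj a₀).2 (by simp)).symm
      refine ⟨S \ {a₁, a₃}, {a₂}, indep (by simp) (by simp) (by simp) (by simp) (by simp)
        (by simp [mv]) (by simp [mv]) (by simp [mv]),
        hS.dominates (fun x hx hxR ↦ ?_) (fun w hw hwR x hwx hB ↦ ?_), ?_⟩
      · rcases removed hx hxR with rfl | rfl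
        exacts [dom h0 e10.symm, dom h4 e34.symm]
      · rcases removed hw hwR with rfl | rfl
        · rcases (hadj₁ x).1 hwx with rfl | rfl | rfl
          exacts [dom h0 ev, Or.inr (Or.inl h0), Or.inl rfl]
        · rcases (hadj₃ x).1 hwx with rfl | rfl | rfl
          exacts [dom h0 ev, Or.inl rfl, Or.inr (Or.inl h4)]
      · have := Set.ncard_sdiff_add_ncard_of_subset (s := {a₁, a₃}) (t := S)
          (by simp [Set.insert_subset_iff, m1, m3])
        rw [Set.ncard_pair n13] at this
        rw [Set.ncard_singleton]
        lia
    · refine ⟨S \ {a₁}, ∅, indep (by simp) (by simp) (by simp [mv]) (by simp [m2]) (by simp [m4])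
        (by simp [mv]) (by simp [mv]) (by simp [mv]),
        hS.dominates (fun x hx hxR ↦ ?_) (fun w hw hwR x hwx hB ↦ ?_),
        sdiff_lt rfl m1⟩
      · obtain rfl := removed hx hxR
        exact dom (w := a₀) ⟨m0, n01⟩ e10.symm
      · obtain rfl := removed hw hwR
        rcases (hadj₁ x).1 hwx with rfl | rfl | rfl
        · exact dom (w := a₃) ⟨m3, Ne.symm n13⟩ e3v
        · exact Or.inr (Or.inl ⟨m0, n01⟩)
        · exact dom (w := a₃) ⟨m3, Ne.symm n13⟩ e32
  by_cases m4 : a₄ ∈ S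
  · refine ⟨S \ {a₃}, ∅, indep (by simp [m0]) (by simp [mv]) (by simp) (by simp) (by simp)
        (by simp [mv]) (by simp [mv]) (by simp [mv]),
        hS.dominates (fun x hx hxR ↦ ?_) (fun w hw hwR x hwx hB ↦ ?_),
      sdiff_lt rfl m3⟩
    · obtain rfl := removed hx hxR
      exact dom (w := a₄) ⟨m4, Ne.symm n34⟩ e34.symm
    · obtain rfl := removed hw hwR
      rcases (hadj₃ x).1 hwx with rfl | rfl | rfl
      · exact dom (w := a₁) ⟨m1, n13⟩ e1v
      · exact dom (w := a₁) ⟨m1, n13⟩ e12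
      · exact Or.inr (Or.inl ⟨m4, Ne.symm n34⟩)
  have m7 : a₇ ∈ S := dv mv m0 m2 m4
  have m6 : a₆ ∉ S := fun m6 ↦ x67 m6 m7
  have m8 := x78 m7
  have m5 : a₅ ∈ S := by_contra fun m5 ↦ m6 (d5 m5 m4)
  have hub : ∀ {x}, G.Adj v x ∨ x = v → x ∈ G.neighborSet a₇ \ {v, a₆, a₈} ∨
      x ∈ insert v (S \ {a₁, a₃, a₅, a₇}) ∨ ∃ w ∈ insert v (S \ {a₁, a₃, a₅, a₇}), G.Adj w x := by
    rintro x (hx | rfl)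
    exacts [dom (Set.mem_insert _ _) hx, Or.inr (Or.inl (Set.mem_insert _ _))]
  refine ⟨insert v (S \ {a₁, a₃, a₅, a₇}), G.neighborSet a₇ \ {v, a₆, a₈}, ?_,
    hS.dominates (fun x hx hxR ↦ hub ?_) (fun w hw hwR x hwx hB ↦ ?_), ?_⟩
  · have not_adj : ∀ x ∈ S \ {a₁, a₃, a₅, a₇}, ¬ G.Adj v x := by
      rintro x ⟨hx, hxR⟩ hvx
      rcases (hadj x).1 hvx with rfl | rfl | rfl | rfl | rfl | rfl | rfl | rfl | rfl
      exacts [m0 hx, hxR (by simp), m2 hx, hxR (by simp), m4 hx, hxR (by simp), m6 hx,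
        hxR (by simp), m8 hx]
    rintro x (rfl | hx) y (rfl | hy) hxy
    · exact hxy.ne rfl
    · exact not_adj y hy hxy
    · exact not_adj x hx hxy.symm
    · exact indep (by simp) (by simp) (by simp) (by simp) (by simp)
        (by simp) (by simp [mv]) (by simp [mv]) x hx y hy hxy
  · rcases removed hx (fun hx' ↦ hxR (Set.mem_insert_of_mem v hx')) with rfl | rfl | rfl | rfl <;>
      simp [hadj]
  · rcases removed hw (fun hw' ↦ hwR (Set.mem_insert_of_mem v hw')) with rfl | rfl | rfl | rfl
    · refine hub ?_
      rw [hadj]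
      rcases (hadj₁ x).1 hwx with rfl | rfl | rfl <;> simp
    · refine hub ?_
      rw [hadj]
      rcases (hadj₃ x).1 hwx with rfl | rfl | rfl <;> simp
    · refine hub ?_
      rw [hadj]
      rcases (hadj₅ x).1 hwx with rfl | rfl | rfl <;> simp
    · by_cases hx : G.Adj v x ∨ x = v
      · exact hub hx
      · refine Or.inl ⟨hwx, ?_⟩
        rintro (rfl | rfl | rfl) <;> simp [hadj] at hx
  · have := Set.ncard_sdiff_add_ncard_of_subset (s := {a₁, a₃, a₅, a₇}) (t := S)
      (by simp [Set.insert_subset_iff, m1, m3, m5, m7])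
    rw [Set.ncard_insert_of_notMem (by simp [n13, n15, n17]),
      Set.ncard_insert_of_notMem (by simp [n35, n37]), Set.ncard_pair n57] at this
    have := Set.ncard_insert_le v (S \ {a₁, a₃, a₅, a₇})
    have := h.ncard_le
    lia

theorem cutEdges_subset [DecidableEq V] (h : G.NineFan v a₀ a₁ a₂ a₃ a₄ a₅ a₆ a₇ a₈) :
    ↑h.cutEdges ⊆ G.edgeSet := by
  intro e he
  simp only [cutEdges, List.coe_toFinset, Set.mem_ofPred_eq, List.mem_cons, List.not_mem_nil,
    or_false] at he
  rcases he with rfl | rfl | rfl | rfl | rfl | rfl | rfl | rfl <;>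
    simp [h.adj_hub, h.adj₁, h.adj₃]

theorem indepDomNum_lt [Finite V] [DecidableEq V]
    (h : G.NineFan v a₀ a₁ a₂ a₃ a₄ a₅ a₆ a₇ a₈) :
    G.indepDomNum < (G.deleteEdges ↑h.cutEdges).indepDomNum := by
  obtain ⟨S, hS, hcard⟩ :=
    (G.deleteEdges ↑h.cutEdges).exists_isIndepDomSet_ncard_eq_indepDomNum
  obtain ⟨T, U, hT, hU, hlt⟩ := h.exists_smaller hS
  exact hcard ▸ (indepDomNum_le_add G T U hT hU).trans_lt hlt

end NineFan

theorem adj_iff_of_ncard_eq_three [Finite V] {G : SimpleGraph V} {a x y z : V}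
    (hcard : (G.neighborSet a).ncard = 3) (hx : G.Adj a x) (hy : G.Adj a y) (hz : G.Adj a z)
    (hxy : x ≠ y) (hxz : x ≠ z) (hyz : y ≠ z) (w : V) : G.Adj a w ↔ w = x ∨ w = y ∨ w = z := by
  have : ({x, y, z} : Set V) = G.neighborSet a :=
    Set.eq_of_subset_of_ncard_le (by simp [Set.insert_subset_iff, hx, hy, hz])
      (by rw [hcard, Set.ncard_insert_of_notMem (by simp [hxy, hxz]), Set.ncard_pair hyz])
  rw [← mem_neighborSet, ← this]
  simp

end SimpleGraph

theorem stmt7 {V : Type*} [Fintype V]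
    (G : SimpleGraph V) (v : V) (u : Fin 9 → V)
    (hinj : Function.Injective u)
    (hdeg : (G.neighborSet v).ncard = 9)
    (hnbr : ∀ i, G.Adj v (u i))
    (hpath : ∀ i : Fin 9, i.val < 8 → G.Adj (u i) (u (i + 1)))
    (hnotwheel : ¬ G.Adj (u 0) (u 8))
    (hd2 : (G.neighborSet (u 1)).ncard = 3)
    (hd4 : (G.neighborSet (u 3)).ncard = 3)
    (hd6 : (G.neighborSet (u 5)).ncard = 3)
    (hd8 : (G.neighborSet (u 7)).ncard ≤ 5)
    (hind : ∀ i ∈ ({1, 3, 5, 7} : Finset (Fin 9)),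
      ∀ j ∈ ({1, 3, 5, 7} : Finset (Fin 9)), ¬ G.Adj (u i) (u j)) :
    ∃ B : Finset (Sym2 V), ↑B ⊆ G.edgeSet ∧ B.card ≤ 8 ∧
      G.indepDomNum < (G.deleteEdges ↑B).indepDomNum := by
  classical
  have hpath' : ∀ i : Fin 9, i.val < 8 → G.Adj (u (i + 1)) (u i) := fun i hi ↦ (hpath i hi).symm
  have hne : ∀ {i j : Fin 9}, i ≠ j → u i ≠ u j := fun hij ↦ hinj.ne hij
  have hrange : Set.range u = G.neighborSet v :=
    Set.eq_of_subset_of_ncard_le (by rintro _ ⟨i, rfl⟩; exact hnbr i)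
      (by rw [hdeg, ← Set.image_univ, Set.ncard_image_of_injective _ hinj, Set.ncard_univ]; simp)
  have h : G.NineFan v (u 0) (u 1) (u 2) (u 3) (u 4) (u 5) (u 6) (u 7) (u 8) :=
    { nodup := by
        refine List.nodup_cons.2 ⟨?_, ?_⟩
        · simp [(hnbr _).ne]
        · exact List.Nodup.map hinj (List.nodup_finRange 9)
      adj_hub := fun x ↦ by
        rw [← SimpleGraph.mem_neighborSet, ← hrange]
        simp [Fin.exists_fin_succ, eq_comm]
      adj₁ := SimpleGraph.adj_iff_of_ncard_eq_three hd2 (hnbr 1).symm (hpath' 0 (by decide))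
        (hpath 1 (by decide)) (hnbr 0).ne (hnbr 2).ne (hne (by decide))
      adj₃ := SimpleGraph.adj_iff_of_ncard_eq_three hd4 (hnbr 3).symm (hpath' 2 (by decide))
        (hpath 3 (by decide)) (hnbr 2).ne (hnbr 4).ne (hne (by decide))
      adj₅ := SimpleGraph.adj_iff_of_ncard_eq_three hd6 (hnbr 5).symm (hpath' 4 (by decide))
        (hpath 5 (by decide)) (hnbr 4).ne (hnbr 6).ne (hne (by decide))
      adj₆₇ := hpath 6 (by decide)
      adj₇₈ := hpath 7 (by decide)
      ncard_le := by
        have hsub : ({v, u 6, u 8} : Set V) ⊆ G.neighborSet (u 7) := by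
          rintro _ (rfl | rfl | rfl)
          exacts [(hnbr 7).symm, hpath' 6 (by decide), hpath 7 (by decide)]
        have := Set.ncard_sdiff_add_ncard_of_subset hsub
        rw [Set.ncard_insert_of_notMem (by simp [(hnbr _).ne]),
          Set.ncard_pair (hne (by decide))] at this
        lia }
  exact ⟨h.cutEdges, h.cutEdges_subset, List.toFinset_card_le _, h.indepDomNum_lt⟩
end

section
/- Let G be a finite simple graph containing a vertex v of degree 8 with distinct neighbors u_1, …, u_8 such that u_2 u_3, u_3 u_4, u_5 u_6, u_6 u_7, u_7 u_8, u_8 u_1 ∈ E(G) while u_1 u_2 ∉ E(G) and u_4 u_5 ∉ E(G). Suppose d(u_1) = d(u_2) = d(u_4) = d(u_5) = 3, d(u_7) ≤ 5, and {u_1, u_2, u_4, u_5, u_7} is an independent set in G. Then there exists a set B of at most 8 edges of G such that γ_i(G − B) > γ_i(G); that is, b_i(G) ≤ 8. -/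
open scoped BigOperators

namespace SimpleGraph

variable {V : Type*}

theorem IsIndepDomSet.indepDomNum_le {G : SimpleGraph V} {S : Set V} (hS : G.IsIndepDomSet S) :
    G.indepDomNum ≤ S.ncard :=
  Nat.sInf_le ⟨S, hS, rfl⟩

variable [Finite V]

/-- An independent set extends to an independent dominating set by adding vertices from any set
that contains all vertices not dominated so far. -/
theorem exists_isIndepDomSet_subset_union {G : SimpleGraph V} {T U : Set V}
    (hT : ∀ x ∈ T, ∀ y ∈ T, ¬ G.Adj x y)
    (hU : ∀ x, x ∈ T ∨ (∃ t ∈ T, G.Adj t x) ∨ x ∈ U) :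
    ∃ S, G.IsIndepDomSet S ∧ S ⊆ T ∪ U := by
  obtain ⟨S, hTS, hS⟩ := (Set.toFinite
    {S : Set V | (∀ x ∈ S, ∀ y ∈ S, ¬ G.Adj x y) ∧ T ⊆ S ∧ S ⊆ T ∪ U}).exists_le_maximal
      (a := T) ⟨hT, subset_rfl, Set.subset_union_left⟩
  refine ⟨S, ⟨hS.prop.1, fun x => ?_⟩, hS.prop.2.2⟩
  by_contra! hx
  obtain ⟨hxS, hxd⟩ := hx
  have hxU : x ∈ U := by
    rcases hU x with h | ⟨t, ht, hadj⟩ | h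
    · exact absurd (hTS h) hxS
    · exact absurd hadj (hxd t (hTS ht))
    · exact h
  have hmem : insert x S ∈
      {S : Set V | (∀ x ∈ S, ∀ y ∈ S, ¬ G.Adj x y) ∧ T ⊆ S ∧ S ⊆ T ∪ U} := by
    refine ⟨?_, hTS.trans (Set.subset_insert _ _),
      Set.insert_subset (Or.inr hxU) hS.prop.2.2⟩
    rintro p (rfl | hp) q (rfl | hq) hpq
    · exact G.irrefl hpq
    · exact hxd q hq hpq.symm
    · exact hxd p hp hpq
    · exact hS.prop.1 p hp q hq hpq
  exact hxS (hS.le_of_ge hmem (Set.subset_insert _ _) (Set.mem_insert _ _))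

theorem indepDomNum_le_ncard_add {G : SimpleGraph V} {T U : Set V}
    (hT : ∀ x ∈ T, ∀ y ∈ T, ¬ G.Adj x y)
    (hU : ∀ x, x ∈ T ∨ (∃ t ∈ T, G.Adj t x) ∨ x ∈ U) :
    G.indepDomNum ≤ T.ncard + U.ncard := by
  obtain ⟨S, hS, hSTU⟩ := exists_isIndepDomSet_subset_union hT hU
  exact hS.indepDomNum_le.trans ((Set.ncard_le_ncard hSTU).trans (Set.ncard_union_le T U))

theorem exists_isIndepDomSet_ncard_eq (G : SimpleGraph V) :
    ∃ S, G.IsIndepDomSet S ∧ S.ncard = G.indepDomNum := by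
  obtain ⟨S, hS, -⟩ := exists_isIndepDomSet_subset_union (G := G) (T := ∅) (U := Set.univ)
    (by simp) (by simp)
  exact Nat.sInf_mem (s := {n | ∃ S : Set V, G.IsIndepDomSet S ∧ S.ncard = n}) ⟨_, S, hS, rfl⟩

/-- If `D = {a, b, c, d}` is an independent set of neighbors of `v`, and `H` arises from `G` by
deleting all edges at `D` other than `va`, `vb`, `vc` and `hd`, where `h` is a common neighbor of
`v`, `b` and `d`, then `H` has larger independent domination number, provided every further
neighbor of `v`, apart from a vertex `w` with few private neighbors, is adjacent to `a` or `c`. -/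
theorem indepDomNum_lt_of_pendant {G H : SimpleGraph V} {v h w a b c d : V} {D : Set V}
    (hD : D = {a, b, c, d}) (hDcard : D.ncard = 4)
    (hDindep : ∀ x ∈ D, ∀ y ∈ D, ¬ G.Adj x y)
    (hle : H ≤ G) (hkeep : ∀ x y, G.Adj x y → x ∉ D → y ∉ D → H.Adj x y)
    (ha : ∀ x, H.Adj a x ↔ x = v) (hb : ∀ x, H.Adj b x ↔ x = v)
    (hc : ∀ x, H.Adj c x ↔ x = v) (hd : ∀ x, H.Adj d x ↔ x = h)
    (hvD : ∀ x ∈ D, G.Adj v x) (hvh : G.Adj v h) (hvw : G.Adj v w) (hhb : G.Adj h b)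
    (hab : a ≠ b) (hbd : b ≠ d) (hwD : w ∉ D)
    (hv : ∀ x, G.Adj v x → x ∈ D ∨ x = w ∨ x = h ∨ G.Adj a x ∨ G.Adj c x)
    (hw : {x | G.Adj w x ∧ ¬ G.Adj v x ∧ x ≠ v}.ncard ≤ 3) :
    G.indepDomNum < H.indepDomNum := by
  obtain ⟨S, ⟨hSi, hSd⟩, hScard⟩ := H.exists_isIndepDomSet_ncard_eq
  rw [← hScard]
  have haD : a ∈ D := by simp [hD]
  have hbD : b ∈ D := by simp [hD]
  have hcD : c ∈ D := by simp [hD]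
  have hdD : d ∈ D := by simp [hD]
  have hvD' : v ∉ D := fun hmem => G.irrefl (hvD v hmem)
  have hhD : h ∉ D := fun hmem => hDindep h hmem b hbD hhb
  have hDadj : ∀ s ∈ D, ∀ x, H.Adj s x → x = v ∨ x = h := by
    intro s hs x hsx
    rw [hD] at hs
    rcases hs with rfl | rfl | rfl | rfl
    · exact Or.inl ((ha x).1 hsx)
    · exact Or.inl ((hb x).1 hsx)
    · exact Or.inl ((hc x).1 hsx)
    · exact Or.inr ((hd x).1 hsx)
  have hmem_of_adj : ∀ {s z}, (∀ x, H.Adj s x ↔ x = z) → z ∉ S → s ∈ S := by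
    intro s z hs hz
    rcases hSd s with h1 | ⟨t, ht, hts⟩
    · exact h1
    · exact absurd ((hs t).1 hts.symm ▸ ht) hz
  set R : Set V := {x | x ∈ D ∧ x ∈ S ∧ ∃ s ∈ S, G.Adj s x} with hR
  have hRS : R ⊆ S := fun x hx => hx.2.1
  have hdiff : (S \ R).ncard + R.ncard = S.ncard := Set.ncard_sdiff_add_ncard_of_subset hRS
  have hTi : ∀ x ∈ S \ R, ∀ y ∈ S \ R, ¬ G.Adj x y := by
    rintro x ⟨hxS, hxR⟩ y ⟨hyS, hyR⟩ hxy
    by_cases hx : x ∈ D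
    · exact hxR ⟨hx, hxS, y, hyS, hxy.symm⟩
    by_cases hy : y ∈ D
    · exact hyR ⟨hy, hyS, x, hxS, hxy⟩
    exact hSi x hxS y hyS (hkeep x y hxy hx hy)
  have hTd : ∀ x, x ∈ S \ R ∨ (∃ t ∈ S \ R, G.Adj t x) ∨ x = v ∨ x = h := by
    intro x
    rcases hSd x with hxS | ⟨s, hsS, hsx⟩
    · by_cases hxR : x ∈ R
      · obtain ⟨hxD, -, s, hsS, hsx⟩ := hxR
        exact Or.inr (Or.inl ⟨s, ⟨hsS, fun hsR => hDindep s hsR.1 x hxD hsx⟩, hsx⟩)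
      · exact Or.inl ⟨hxS, hxR⟩
    · by_cases hsR : s ∈ R
      · exact Or.inr (Or.inr (hDadj s hsR.1 x hsx))
      · exact Or.inr (Or.inl ⟨s, ⟨hsS, hsR⟩, hle hsx⟩)
  rcases R.eq_empty_or_nonempty with hR0 | hRne
  · have hnR : ∀ x ∈ D, x ∈ S → ∀ s ∈ S, ¬ G.Adj s x := fun x hxD hxS s hsS hsx => by
      have hmem : x ∈ R := ⟨hxD, hxS, s, hsS, hsx⟩
      simp [hR0] at hmem
    have hvS : v ∉ S := by
      intro hvS
      have hhS : h ∉ S := fun hhS => hSi v hvS h hhS (hkeep v h hvh hvD' hhD)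
      exact hnR d hdD (hmem_of_adj hd hhS) v hvS (hvD d hdD)
    have haS := hmem_of_adj ha hvS
    have hbS := hmem_of_adj hb hvS
    have hcS := hmem_of_adj hc hvS
    have hhS : h ∉ S := fun hhS => hnR b hbD hbS h hhS hhb
    have hdS := hmem_of_adj hd hhS
    have hDS : D ⊆ S := by
      rw [hD]; rintro x (rfl | rfl | rfl | rfl) <;> assumption
    have hvN : ∀ x ∈ S, G.Adj v x → x ∈ insert w D := by
      intro x hxS hvx
      rcases hv x hvx with h1 | h1 | h1 | h1 | h1
      · exact Or.inr h1
      · exact Or.inl h1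
      · exact absurd (h1 ▸ hxS) hhS
      · exact absurd h1.symm (hnR a haD haS x hxS)
      · exact absurd h1.symm (hnR c hcD hcS x hxS)
    have hTvi : ∀ x ∈ insert v (S \ insert w D), ∀ y ∈ insert v (S \ insert w D),
        ¬ G.Adj x y := by
      rintro x (rfl | ⟨hxS, hxE⟩) y (rfl | ⟨hyS, hyE⟩) hxy
      · exact G.irrefl hxy
      · exact hyE (hvN y hyS hxy)
      · exact hxE (hvN x hxS hxy.symm)
      · exact hSi x hxS y hyS
          (hkeep x y hxy (fun hx => hxE (Or.inr hx)) (fun hy => hyE (Or.inr hy)))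
    have hTvd : ∀ x, x ∈ insert v (S \ insert w D) ∨
        (∃ t ∈ insert v (S \ insert w D), G.Adj t x) ∨
        (w ∈ S ∧ G.Adj w x ∧ ¬ G.Adj v x ∧ x ≠ v) := by
      intro x
      by_cases hxv : x = v
      · exact Or.inl (Or.inl hxv)
      by_cases hvx : G.Adj v x
      · exact Or.inr (Or.inl ⟨v, Or.inl rfl, hvx⟩)
      rcases hSd x with hxS | ⟨s, hsS, hsx⟩
      · refine Or.inl (Or.inr ⟨hxS, ?_⟩)
        rintro (rfl | hxD)
        · exact hvx hvw
        · exact hvx (hvD x hxD)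
      · by_cases hsw : s = w
        · subst hsw
          exact Or.inr (Or.inr ⟨hsS, hle hsx, hvx, hxv⟩)
        by_cases hsD : s ∈ D
        · rcases hDadj s hsD x hsx with rfl | rfl
          · exact absurd rfl hxv
          · exact absurd hvh hvx
        · exact Or.inr (Or.inl ⟨s, Or.inr ⟨hsS, by simp [hsw, hsD]⟩, hle hsx⟩)
    have hins := Set.ncard_insert_le v (S \ insert w D)
    by_cases hwS : w ∈ S
    · have hcard := Set.ncard_sdiff_add_ncard_of_subset (Set.insert_subset hwS hDS)
      rw [Set.ncard_insert_of_notMem hwD, hDcard] at hcard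
      have hfin := indepDomNum_le_ncard_add hTvi
        (U := {x | G.Adj w x ∧ ¬ G.Adj v x ∧ x ≠ v})
        fun x => (hTvd x).imp_right fun hx => hx.imp_right And.right
      omega
    · have hcard := Set.ncard_sdiff_add_ncard_of_subset hDS
      have hsub := Set.ncard_le_ncard
        (Set.sdiff_subset_sdiff_right (s := S) (Set.subset_insert w D))
      have hfin := indepDomNum_le_ncard_add hTvi (U := ∅)
        fun x => (hTvd x).imp_right fun hx => hx.imp_right fun h1 => absurd h1.1 hwS
      rw [Set.ncard_empty] at hfin
      omega
  · have hRpos := (Set.ncard_pos).2 hRne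
    have hlarge : ∀ x ∈ R, ∀ y ∈ R, x ≠ y → 2 ≤ R.ncard := fun x hx y hy hxy =>
      (Set.one_lt_ncard_iff).2 ⟨x, y, hx, hy, hxy⟩
    by_cases hvdom : v ∈ S \ R ∨ ∃ t ∈ S \ R, G.Adj t v
    · by_cases hhdom : h ∈ S \ R ∨ ∃ t ∈ S \ R, G.Adj t h
      · have hfin := indepDomNum_le_ncard_add hTi (U := ∅) fun x => by
          rcases hTd x with hx | hx | rfl | rfl
          exacts [Or.inl hx, Or.inr (Or.inl hx), hvdom.imp_right Or.inl, hhdom.imp_right Or.inl]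
        rw [Set.ncard_empty] at hfin
        omega
      · push Not at hhdom
        obtain ⟨hh, hhn⟩ := hhdom
        have hvS : v ∉ S := fun hvS => hhn v ⟨hvS, fun hvR => hvD' hvR.1⟩ hvh
        have hhS : h ∉ S := fun hhS => hh ⟨hhS, fun hhR => hhD hhR.1⟩
        have hbS := hmem_of_adj hb hvS
        have hdS := hmem_of_adj hd hhS
        have hbR : b ∈ R := by
          by_contra hbR
          exact hhn b ⟨hbS, hbR⟩ hhb.symm
        have hdR : d ∈ R := by
          by_contra hdR
          exact hhn d ⟨hdS, hdR⟩ (hle ((hd h).2 rfl))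
        have hRtwo := hlarge b hbR d hdR hbd
        have hfin := indepDomNum_le_ncard_add hTi (U := {h}) fun x => by
          rcases hTd x with hx | hx | rfl | rfl
          exacts [Or.inl hx, Or.inr (Or.inl hx), hvdom.imp_right Or.inl, Or.inr (Or.inr rfl)]
        rw [Set.ncard_singleton] at hfin
        omega
    · push Not at hvdom
      obtain ⟨hvR, hvn⟩ := hvdom
      have hvS : v ∉ S := fun hvS => hvR ⟨hvS, fun hvR => hvD' hvR.1⟩
      have haR : a ∈ R := by
        by_contra haR
        exact hvn a ⟨hmem_of_adj ha hvS, haR⟩ (hvD a haD).symm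
      have hbR : b ∈ R := by
        by_contra hbR
        exact hvn b ⟨hmem_of_adj hb hvS, hbR⟩ (hvD b hbD).symm
      have hRtwo := hlarge a haR b hbR hab
      have hins := Set.ncard_insert_le v (S \ R)
      have hfin := indepDomNum_le_ncard_add (G := G) (T := insert v (S \ R))
        (U := ∅) ?_ ?_
      · rw [Set.ncard_empty] at hfin
        omega
      · rintro x (rfl | hx) y (rfl | hy) hxy
        · exact G.irrefl hxy
        · exact hvn y hy hxy.symm
        · exact hvn x hx hxy
        · exact hTi x hx y hy hxy
      · intro x
        rcases hTd x with hx | ⟨t, ht, htx⟩ | rfl | rfl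
        · exact Or.inl (Or.inr hx)
        · exact Or.inr (Or.inl ⟨t, Or.inr ht, htx⟩)
        · exact Or.inl (Or.inl rfl)
        · exact Or.inr (Or.inl ⟨v, Or.inl rfl, hvh⟩)

/-- A vertex of degree three with two known neighbors has exactly one further neighbor. -/
theorem exists_third_neighbor {G : SimpleGraph V} {a p q : V} (hdeg : (G.neighborSet a).ncard = 3)
    (hp : G.Adj a p) (hq : G.Adj a q) (hpq : p ≠ q) :
    ∃ x, x ≠ p ∧ ∀ y, G.Adj a y ↔ y = p ∨ y = q ∨ y = x := by
  have hsub : {p, q} ⊆ G.neighborSet a := Set.insert_subset hp (Set.singleton_subset_iff.2 hq)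
  have hcard := Set.ncard_sdiff_add_ncard_of_subset hsub
  rw [Set.ncard_pair hpq, hdeg] at hcard
  obtain ⟨x, hx⟩ := Set.ncard_eq_one.1 (by omega : (G.neighborSet a \ {p, q}).ncard = 1)
  have hmem : ∀ y, (G.Adj a y ∧ ¬ (y = p ∨ y = q)) ↔ y = x := fun y => by
    simpa using Set.ext_iff.1 hx y
  have hxx := (hmem x).2 rfl
  refine ⟨x, fun h => hxx.2 (Or.inl h), fun y => ⟨fun hy => ?_, ?_⟩⟩
  · have := hmem y
    tauto
  · rintro (rfl | rfl | rfl)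
    exacts [hp, hq, hxx.1]

end SimpleGraph

theorem stmt11 {V : Type*} [Fintype V]
    (G : SimpleGraph V) (v : V) (u : Fin 8 → V)
    (hinj : Function.Injective u)
    (hdeg : (G.neighborSet v).ncard = 8)
    (hnbr : ∀ i, G.Adj v (u i))
    (he23 : G.Adj (u 1) (u 2)) (he34 : G.Adj (u 2) (u 3))
    (he56 : G.Adj (u 4) (u 5)) (he67 : G.Adj (u 5) (u 6))
    (he78 : G.Adj (u 6) (u 7)) (he81 : G.Adj (u 7) (u 0))
    (hn12 : ¬ G.Adj (u 0) (u 1)) (hn45 : ¬ G.Adj (u 3) (u 4))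
    (hd1 : (G.neighborSet (u 0)).ncard = 3)
    (hd2 : (G.neighborSet (u 1)).ncard = 3)
    (hd4 : (G.neighborSet (u 3)).ncard = 3)
    (hd5 : (G.neighborSet (u 4)).ncard = 3)
    (hd7 : (G.neighborSet (u 6)).ncard ≤ 5)
    (hind : ∀ i ∈ ({0, 1, 3, 4, 6} : Finset (Fin 8)),
      ∀ j ∈ ({0, 1, 3, 4, 6} : Finset (Fin 8)), ¬ G.Adj (u i) (u j)) :
    ∃ B : Finset (Sym2 V), ↑B ⊆ G.edgeSet ∧ B.card ≤ 8 ∧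
      G.indepDomNum < (G.deleteEdges ↑B).indepDomNum := by
  classical
  have hne : ∀ {i j : Fin 8}, i ≠ j → u i ≠ u j := fun hij => hinj.ne hij
  have huv : ∀ i, u i ≠ v := fun i => (hnbr i).ne'
  have hv : ∀ i, v ≠ u i := fun i => (hnbr i).ne
  have hnv : ∀ x, G.Adj v x → ∃ i, u i = x := by
    have hsub : Set.range u ⊆ G.neighborSet v := by
      rintro _ ⟨i, rfl⟩
      exact hnbr i
    have hcard : (Set.range u).ncard = 8 := by
      rw [← Set.image_univ, Set.ncard_image_of_injective _ hinj, Set.ncard_univ, Nat.card_fin]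
    have heq := Set.eq_of_subset_of_ncard_le hsub (by rw [hdeg, hcard])
    intro x hx
    exact (heq ▸ hx : x ∈ Set.range u)
  obtain ⟨x₁, hx₁, h₁⟩ :=
    G.exists_third_neighbor hd1 (hnbr 0).symm he81.symm (huv 7).symm
  obtain ⟨x₂, hx₂, h₂⟩ := G.exists_third_neighbor hd2 (hnbr 1).symm he23 (huv 2).symm
  obtain ⟨x₄, hx₄, h₄⟩ := G.exists_third_neighbor hd4 he34.symm (hnbr 3).symm (huv 2)
  obtain ⟨x₅, hx₅, h₅⟩ := G.exists_third_neighbor hd5 (hnbr 4).symm he56 (huv 5).symm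
  let B : Finset (Sym2 V) := {s(u 0, u 7), s(u 0, x₁), s(u 1, u 2), s(u 1, x₂),
    s(u 3, v), s(u 3, x₄), s(u 4, u 5), s(u 4, x₅)}
  have hDi : ∀ x ∈ ({u 0, u 1, u 4, u 3} : Set V), ∀ y ∈ ({u 0, u 1, u 4, u 3} : Set V),
      ¬ G.Adj x y := by
    rintro _ (rfl | rfl | rfl | rfl) _ (rfl | rfl | rfl | rfl) <;>
      exact hind _ (by decide) _ (by decide)
  have hkept : ∀ x y, (G.deleteEdges ↑B).Adj x y ↔ G.Adj x y ∧ s(x, y) ∉ B := fun x y => by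
    rw [SimpleGraph.deleteEdges_adj, Finset.mem_coe]
  refine ⟨B, ?_, ?_, SimpleGraph.indepDomNum_lt_of_pendant (v := v) (h := u 2)
    (w := u 6) (a := u 0) (b := u 1) (c := u 4) (d := u 3) rfl ?_ hDi (G.deleteEdges_le _)
    ?_ ?_ ?_ ?_ ?_ ?_ (hnbr 2) (hnbr 6) he23.symm (hne (by decide)) (hne (by decide)) ?_ ?_ ?_⟩
  · intro e he
    simp only [B, Finset.coe_insert, Finset.coe_singleton, Set.mem_insert_iff,
      Set.mem_singleton_iff] at he
    rcases he with rfl | rfl | rfl | rfl | rfl | rfl | rfl | rfl <;>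
      simp [h₁, h₂, h₄, h₅]
  · refine (Finset.card_insert_le _ _).trans (Nat.succ_le_succ ?_)
    refine (Finset.card_insert_le _ _).trans (Nat.succ_le_succ ?_)
    exact Finset.card_le_six
  · rw [Set.ncard_insert_of_notMem, Set.ncard_insert_of_notMem, Set.ncard_pair (hne (by decide))]
      <;> simp [hinj.eq_iff]
  · intro x y hxy hx hy
    rw [hkept]
    refine ⟨hxy, ?_⟩
    simp only [Set.mem_insert_iff, Set.mem_singleton_iff, not_or] at hx hy
    simp only [B, Finset.mem_insert, Finset.mem_singleton, Sym2.eq_iff]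
    tauto
  · intro x
    rw [hkept, h₁]
    constructor
    · rintro ⟨rfl | rfl | rfl, hB⟩ <;> simp [B] at hB ⊢
    · rintro rfl
      simp [B, hinj.eq_iff, huv, hv, hx₁.symm]
  · intro x
    rw [hkept, h₂]
    constructor
    · rintro ⟨rfl | rfl | rfl, hB⟩ <;> simp [B] at hB ⊢
    · rintro rfl
      simp [B, hinj.eq_iff, huv, hv, hx₂.symm]
  · intro x
    rw [hkept, h₅]
    constructor
    · rintro ⟨rfl | rfl | rfl, hB⟩ <;> simp [B] at hB ⊢
    · rintro rfl
      simp [B, hinj.eq_iff, huv, hv, hx₅.symm]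
  · intro x
    rw [hkept, h₄]
    constructor
    · rintro ⟨rfl | rfl | rfl, hB⟩ <;> simp [B] at hB ⊢
    · rintro rfl
      simp [B, hinj.eq_iff, huv, hx₄.symm]
  · rintro _ (rfl | rfl | rfl | rfl) <;> exact hnbr _
  · simp [hinj.eq_iff]
  · intro x hx
    obtain ⟨i, rfl⟩ := hnv x hx
    fin_cases i <;> simp [he81.symm, he56]
  · have hsub : {x | G.Adj (u 6) x ∧ ¬ G.Adj v x ∧ x ≠ v} ⊆
        G.neighborSet (u 6) \ {v, u 5} := by
      rintro x ⟨hx, hvx, hxv⟩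
      refine ⟨hx, ?_⟩
      rintro (rfl | rfl)
      exacts [hxv rfl, hvx (hnbr 5)]
    have hcard := Set.ncard_sdiff_add_ncard_of_subset
      (Set.insert_subset (hnbr 6).symm (Set.singleton_subset_iff.2 he67.symm) :
        {v, u 5} ⊆ G.neighborSet (u 6))
    rw [Set.ncard_pair (huv 5).symm] at hcard
    have hle := Set.ncard_le_ncard hsub
    omega
end
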